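/- Let R be a regular local ring, u_1,...,u_k part of a regular system of parameters, and a_1,...,a_k positive rationals. Then the integral closure of the ideal generated by the formal fractional powers (u_1^{a_1},...,u_k^{a_k}) (i.e., the ideal of sections of this Q-ideal) is generated by the monomials u_1^{c_1}···u_k^{c_k} with c_i ∈ N satisfying c_1/a_1 + ... + c_k/a_k ≥ 1. -/

import Mathlib

/-- `u` is part of a regular system of parameters of the (regular) local ring `R`. -/
def IsPartialRegSystemOfParams {R : Type*} [CommRing R] [IsLocalRing R] {k : ℕ}
    (u : Fin k → R) : Prop :=
  ∃ (n : ℕ) (v : Fin n → R) (e : Fin k ↪ Fin n),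
    (∀ i, v (e i) = u i) ∧
    Ideal.span (Set.range v) = IsLocalRing.maximalIdeal R ∧
    ringKrullDim R = n

/-- `f` belongs to the integral closure of the ideal `J`. -/
def MemIntegralClosureOfIdeal {R : Type*} [CommRing R] (J : Ideal R) (f : R) : Prop :=
  ∃ n : ℕ, 0 < n ∧ ∃ c : Fin n → R, (∀ i : Fin n, c i ∈ J ^ ((i : ℕ) + 1)) ∧
    f ^ n + ∑ i, c i * f ^ (n - 1 - (i : ℕ)) = 0

open IsLocalRing in
/-- A Noetherian local ring whose maximal ideal is generated by at most `dim R` elements is a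
domain. -/
theorem isDomain_of_span_eq_maximalIdeal (n : ℕ) :
    ∀ (R : Type*) [CommRing R] [IsLocalRing R] [IsNoetherianRing R] (s : Finset R),
      Ideal.span (s : Set R) = maximalIdeal R → s.card ≤ n → (n : WithBot ℕ∞) ≤ ringKrullDim R →
      IsDomain R := by
  classical
  induction n with
  | zero =>
    intro R _ _ _ s hs hc _
    have : s = ∅ := by simpa using hc
    subst this
    have : IsField R := isField_iff_maximalIdeal_eq.2 (by simpa using hs.symm)
    exact this.isDomain
  | succ n ih =>
    intro R _ _ _ s hs hc hd
    have hfin := minimalPrimes.finite_of_isNoetherianRing R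
    have hsq : ¬ maximalIdeal R ≤ maximalIdeal R ^ 2 := by
      refine not_le_of_gt (maximalIdeal_sq_lt_of_ringKrullDim_ne_zero fun h => ?_)
      rw [h] at hd
      norm_cast at hd
    have hmin : ∀ q ∈ minimalPrimes R, ¬ maximalIdeal R ≤ q := by
      intro q hq h
      have hq' : maximalIdeal R ∈ minimalPrimes R := by
        have : q = maximalIdeal R :=
          le_antisymm (le_maximalIdeal hq.1.1.ne_top) h
        rwa [← this]
      have := maximalIdeal_height_eq_ringKrullDim (R := R)
      rw [Ideal.height_eq_zero_iff.2 hq'] at this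
      rw [← this] at hd
      norm_cast at hd
    obtain ⟨x, hxm, hx2, hxq⟩ : ∃ x ∈ maximalIdeal R, x ∉ maximalIdeal R ^ 2 ∧
        ∀ q ∈ minimalPrimes R, x ∉ q := by
      by_contra! hcon
      have := (Ideal.subset_union_prime_finite (s := insert (maximalIdeal R ^ 2) (minimalPrimes R))
        (hfin.insert _) (f := id) (maximalIdeal R ^ 2) (maximalIdeal R ^ 2)
        (by
          intro q hq h1 _
          rcases hq with rfl | hq
          · exact absurd rfl h1
          · exact hq.1.1) (I := maximalIdeal R)).1 (by
          intro x hx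
          by_cases h2 : x ∈ maximalIdeal R ^ 2
          · exact Set.mem_biUnion (Set.mem_insert _ _) h2
          · obtain ⟨q, hq, hxq⟩ := hcon x hx h2
            exact Set.mem_biUnion (Set.mem_insert_of_mem _ hq) hxq)
      obtain ⟨q, rfl | hq, h⟩ := this
      · exact hsq h
      · exact hmin q hq h
    obtain ⟨r, hr⟩ : ∃ r : R → R, ∑ a ∈ s, r a * a = x := by
      have : x ∈ Ideal.span (s : Set R) := hs ▸ hxm
      obtain ⟨r, -, hr⟩ := Submodule.mem_span_finset.1 this
      exact ⟨r, by simpa using hr⟩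
    obtain ⟨b, hb, hub⟩ : ∃ b ∈ s, IsUnit (r b) := by
      by_contra! hcon
      apply hx2
      rw [← hr, pow_two]
      exact Ideal.sum_mem _ fun a ha => Ideal.mul_mem_mul
        ((mem_maximalIdeal _).2 (hcon a ha)) (hs ▸ Ideal.subset_span ha)
    have hxtop : Ideal.span {x} ≠ ⊤ := by
      rw [Ne, Ideal.span_singleton_eq_top]; exact hxm
    have : Nontrivial (R ⧸ Ideal.span {x}) := Ideal.Quotient.nontrivial_iff.2 hxtop
    have : IsLocalRing (R ⧸ Ideal.span {x}) :=
      IsLocalRing.of_surjective' (Ideal.Quotient.mk _) Ideal.Quotient.mk_surjective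
    have hdom : IsDomain (R ⧸ Ideal.span {x}) := by
      refine ih _ ((s.erase b).image (Ideal.Quotient.mk (Ideal.span {x}))) ?_ ?_ ?_
      · rw [Finset.coe_image, ← Ideal.map_span]
        have hmx : Ideal.map (Ideal.Quotient.mk (Ideal.span {x})) (maximalIdeal R)
            = maximalIdeal _ :=
          IsLocalRing.map_maximalIdeal_of_surjective _ Ideal.Quotient.mk_surjective
        rw [← hmx]
        apply le_antisymm
        · apply Ideal.map_mono
          rw [← hs]
          exact Ideal.span_mono (by simp)
        · rw [← hs, Ideal.map_span, Ideal.span_le]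
          rintro _ ⟨a, ha, rfl⟩
          by_cases hab : a = b
          · subst hab
            obtain ⟨w, hw⟩ := hub
            have h1 : (Ideal.Quotient.mk (Ideal.span {x})) (r a * a) =
                - (Ideal.Quotient.mk (Ideal.span {x})) (∑ i ∈ s.erase a, r i * i) := by
              rw [← Finset.add_sum_erase _ _ ha] at hr
              rw [← map_neg, Ideal.Quotient.eq, sub_neg_eq_add, hr]
              exact Ideal.mem_span_singleton_self x
            have h2 : (Ideal.Quotient.mk (Ideal.span {x})) a =
                Ideal.Quotient.mk _ (↑w⁻¹ : R) * Ideal.Quotient.mk _ (r a * a) := by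
              rw [← hw, ← map_mul]; simp
            rw [h2, h1]
            apply Ideal.mul_mem_left
            apply neg_mem
            apply Ideal.mem_map_of_mem
            exact Ideal.sum_mem _ fun i hi => Ideal.mul_mem_left _ _ (Ideal.subset_span hi)
          · exact Ideal.mem_map_of_mem _ (Ideal.subset_span (by simp [hab]; exact ha))
      · refine Finset.card_image_le.trans ?_
        rw [Finset.card_erase_of_mem hb]; omega
      · have h1 := ringKrullDim_le_ringKrullDim_quotient_add_card (R := R) {x}
          (by simpa [ringJacobson_eq_maximalIdeal] using hxm)
        have h2 := hd.trans h1
        rw [Finset.coe_singleton, Finset.card_singleton, Nat.cast_add] at h2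
        exact ENat.WithBot.add_le_add_natCast_right_iff.1 h2
    have hp : (Ideal.span {x}).IsPrime := (Ideal.Quotient.isDomain_iff_prime _).1 hdom
    obtain ⟨q, hq, hqx⟩ := Ideal.exists_minimalPrimes_le (I := ⊥) (J := Ideal.span {x}) bot_le
    have hqp : q.IsPrime := hq.1.1
    have hq0 : q = ⊥ := by
      apply Submodule.eq_bot_of_le_smul_of_le_jacobson_bot (maximalIdeal R) _
          (IsNoetherian.noetherian _) _ (IsLocalRing.maximalIdeal_le_jacobson _)
      intro y hy
      obtain ⟨z, rfl⟩ := Ideal.mem_span_singleton.1 (hqx hy)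
      exact Ideal.mul_mem_mul hxm ((hqp.mem_or_mem hy).resolve_left (hxq q hq))
    subst hq0
    exact IsDomain.of_bot_isPrime R

/-- If the `n = dim R` elements `v i` generate the maximal ideal of `R`, then every subfamily of `v`
generates a prime ideal. -/
theorem isPrime_span_image_of_span_eq_maximalIdeal {R : Type*} [CommRing R] [IsLocalRing R]
    [IsNoetherianRing R] {n : ℕ} {v : Fin n → R}
    (hv : Ideal.span (Set.range v) = IsLocalRing.maximalIdeal R) (hd : ringKrullDim R = n)
    (T : Finset (Fin n)) : (Ideal.span (v '' T)).IsPrime := by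
  classical
  have hle : Ideal.span (v '' T) ≤ IsLocalRing.maximalIdeal R :=
    hv ▸ Ideal.span_mono (Set.image_subset_range _ _)
  have hne : Ideal.span (v '' T) ≠ ⊤ := fun h =>
    (IsLocalRing.maximalIdeal.isMaximal R).ne_top (top_le_iff.1 (h ▸ hle))
  have : Nontrivial (R ⧸ Ideal.span (v '' T)) := Ideal.Quotient.nontrivial_iff.2 hne
  have : IsLocalRing (R ⧸ Ideal.span (v '' T)) :=
    IsLocalRing.of_surjective' (Ideal.Quotient.mk _) Ideal.Quotient.mk_surjective
  rw [← Ideal.Quotient.isDomain_iff_prime]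
  refine isDomain_of_span_eq_maximalIdeal Tᶜ.card _
    (Tᶜ.image fun i => Ideal.Quotient.mk (Ideal.span (v '' T)) (v i)) ?_ Finset.card_image_le ?_
  · rw [← IsLocalRing.map_maximalIdeal_of_surjective _ (Ideal.Quotient.mk_surjective
      (I := Ideal.span (v '' T))), ← hv, Ideal.map_span]
    apply le_antisymm
    · apply Ideal.span_mono
      intro x hx
      simp only [Finset.coe_image, Set.mem_image] at hx
      obtain ⟨i, -, rfl⟩ := hx
      exact ⟨v i, ⟨i, rfl⟩, rfl⟩
    · rw [Ideal.span_le]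
      rintro _ ⟨_, ⟨i, rfl⟩, rfl⟩
      by_cases hi : i ∈ T
      · have : Ideal.Quotient.mk (Ideal.span (v '' T)) (v i) = 0 :=
          Ideal.Quotient.eq_zero_iff_mem.2 (Ideal.subset_span ⟨i, hi, rfl⟩)
        rw [this]
        exact zero_mem _
      · exact Ideal.subset_span
          (Finset.mem_coe.2 (Finset.mem_image.2 ⟨i, Finset.mem_compl.2 hi, rfl⟩))
  · have h1 := ringKrullDim_le_ringKrullDim_quotient_add_card (R := R) (T.image v) (by
      rw [IsLocalRing.ringJacobson_eq_maximalIdeal, Finset.coe_image]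
      exact Ideal.subset_span.trans hle)
    rw [hd, Finset.coe_image] at h1
    have h2 : ((Tᶜ.card + T.card : ℕ) : WithBot ℕ∞) ≤
        ringKrullDim (R ⧸ Ideal.span (v '' T)) + (T.card : ℕ) := by
      rw [Finset.card_compl_add_card, Fintype.card_fin]
      refine h1.trans ?_
      gcongr
      exact Finset.card_image_le
    rw [Nat.cast_add] at h2
    exact ENat.WithBot.add_le_add_natCast_right_iff.1 h2

/-- If the `n = dim R` elements `v i` generate the maximal ideal of `R`, then no `v j` lies in the
ideal generated by other members of the family. -/
theorem notMem_span_image_of_span_eq_maximalIdeal {R : Type*} [CommRing R] [IsLocalRing R]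
    [IsNoetherianRing R] {n : ℕ} {v : Fin n → R}
    (hv : Ideal.span (Set.range v) = IsLocalRing.maximalIdeal R) (hd : ringKrullDim R = n)
    {T : Finset (Fin n)} {j : Fin n} (hj : j ∉ T) : v j ∉ Ideal.span (v '' T) := by
  classical
  intro hmem
  have hspan : Ideal.span (((Finset.univ.erase j).image v : Finset R) : Set R) =
      IsLocalRing.maximalIdeal R := by
    rw [← hv]
    apply le_antisymm
    · apply Ideal.span_mono
      intro x hx
      simp only [Finset.coe_image, Set.mem_image] at hx
      obtain ⟨i, -, rfl⟩ := hx
      exact ⟨i, rfl⟩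
    · rw [Ideal.span_le]
      rintro _ ⟨i, rfl⟩
      by_cases hi : i = j
      · subst hi
        refine Ideal.span_mono ?_ hmem
        rintro _ ⟨l, hl, rfl⟩
        have : l ≠ i := by rintro rfl; exact hj hl
        exact Finset.mem_coe.2 (Finset.mem_image_of_mem _ (by simp [this]))
      · exact Ideal.subset_span (Finset.mem_coe.2 (Finset.mem_image_of_mem _ (by simp [hi])))
  have h1 : (IsLocalRing.maximalIdeal R).spanFinrank ≤ n - 1 := by
    rw [← hspan]
    refine (Submodule.spanFinrank_span_le_ncard_of_finite (Finset.finite_toSet _)).trans ?_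
    rw [Set.ncard_coe_finset]
    refine Finset.card_image_le.trans ?_
    simp
  have h2 := ringKrullDim_le_spanFinrank_maximalIdeal R
  rw [hd] at h2
  have h3 : n ≤ (IsLocalRing.maximalIdeal R).spanFinrank := by exact_mod_cast h2
  have := j.pos
  omega

/-- Every subfamily of `u` generates a prime ideal, which contains no other member of `u`. -/
structure HasPrimeSubfamilies {R ι : Type*} [CommRing R] (u : ι → R) : Prop where
  isPrime_span (T : Finset ι) : (Ideal.span (u '' T)).IsPrime
  notMem_span {T : Finset ι} {j : ι} (hj : j ∉ T) : u j ∉ Ideal.span (u '' T)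

theorem IsPartialRegSystemOfParams.hasPrimeSubfamilies {R : Type*} [CommRing R] [IsLocalRing R]
    [IsNoetherianRing R] {k : ℕ} {u : Fin k → R} (hu : IsPartialRegSystemOfParams u) :
    HasPrimeSubfamilies u := by
  obtain ⟨n, v, e, he, hv, hd⟩ := hu
  have himage (T : Finset (Fin k)) : u '' T = v '' (T.map e) := by
    rw [Finset.coe_map, Set.image_image]
    exact Set.image_congr fun i _ => (he i).symm
  constructor
  · intro T
    rw [himage]
    exact isPrime_span_image_of_span_eq_maximalIdeal hv hd _
  · intro T j hj
    rw [himage, ← he]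
    exact notMem_span_image_of_span_eq_maximalIdeal hv hd (by simpa using hj)

theorem mem_span_image_iff_of_mem {R ι : Type*} [CommRing R] [DecidableEq ι] {w : ι → R}
    {T : Finset ι} {i : ι} (hi : i ∈ T) {x : R} :
    x ∈ Ideal.span (w '' T) ↔ ∃ s, x - w i * s ∈ Ideal.span (w '' (T.erase i)) := by
  have : (T : Set ι) = insert i ((T.erase i : Finset ι) : Set ι) := by
    rw [← Finset.coe_insert, Finset.insert_erase hi]
  rw [this, Set.image_insert_eq, Ideal.mem_span_insert]
  constructor
  · rintro ⟨s, z, hz, rfl⟩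
    exact ⟨s, by simpa [mul_comm] using hz⟩
  · rintro ⟨s, hs⟩
    exact ⟨s, _, hs, by ring⟩

namespace HasPrimeSubfamilies

variable {R ι : Type*} [CommRing R] {u : ι → R}

theorem isDomain (hu : HasPrimeSubfamilies u) : IsDomain R := by
  have : (⊥ : Ideal R).IsPrime := by simpa using hu.isPrime_span ∅
  exact IsDomain.of_bot_isPrime R

theorem ne_zero (hu : HasPrimeSubfamilies u) (i : ι) : u i ≠ 0 := by
  simpa using hu.notMem_span (Finset.notMem_empty i)

/-- `u j` is a nonzerodivisor modulo powers of other members of the family. -/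
theorem mem_span_pow_of_mul_mem (hu : HasPrimeSubfamilies u) (M : ℕ) :
    ∀ (T : Finset ι) (d : ι → ℕ), (∀ i ∈ T, 1 ≤ d i) → ∑ i ∈ T, d i ≤ M → ∀ j ∉ T, ∀ s,
      u j * s ∈ Ideal.span ((fun i => u i ^ d i) '' T) →
      s ∈ Ideal.span ((fun i => u i ^ d i) '' T) := by
  classical
  induction M with
  | zero =>
    intro T d hd hM j hj s hs
    have : T = ∅ := by
      refine Finset.eq_empty_of_forall_notMem fun i hi => ?_
      have h1 := hd i hi
      have h2 := Finset.single_le_sum (f := d) (fun _ _ => Nat.zero_le _) hi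
      omega
    subst this
    have := hu.isDomain
    have hj0 := hu.ne_zero j
    simpa [hj0] using hs
  | succ M ih =>
    intro T d hd hM j hj s hs
    by_cases hall : ∀ i ∈ T, d i = 1
    · have himage : (fun i => u i ^ d i) '' T = u '' T :=
        Set.image_congr fun i hi => by simp [hall i hi]
      rw [himage] at hs ⊢
      exact ((hu.isPrime_span T).mem_or_mem hs).resolve_left (hu.notMem_span hj)
    · push Not at hall
      obtain ⟨i, hi, hdi⟩ := hall
      have hdi1 := hd i hi
      obtain ⟨a, ha⟩ : ∃ a, d i = a + 1 + 1 := ⟨d i - 2, by omega⟩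
      have hji : j ≠ i := by rintro rfl; exact hj hi
      have herase (c : ℕ) : (fun l => u l ^ Function.update d i c l) '' (T.erase i) =
          (fun l => u l ^ d l) '' (T.erase i) :=
        Set.image_congr fun l hl => by
          have : l ≠ i := Finset.ne_of_mem_erase hl
          simp [this]
      have hsum := Finset.add_sum_erase T d hi
      have hlower (c : ℕ) (hc : 1 ≤ c) (hca : c ≤ a + 1) (t : R)
          (ht : ∃ r, u j * t - u i ^ c * r ∈ Ideal.span ((fun l => u l ^ d l) '' (T.erase i))) :
          ∃ r, t - u i ^ c * r ∈ Ideal.span ((fun l => u l ^ d l) '' (T.erase i)) := by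
        have key := ih T (Function.update d i c) (fun l hl => ?_) ?_ j hj t
        · rw [mem_span_image_iff_of_mem hi, mem_span_image_iff_of_mem hi, herase] at key
          simpa using key (by simpa using ht)
        · by_cases hli : l = i
          · subst hli; simpa using hc
          · simpa [hli] using hd l hl
        · rw [Finset.sum_update_of_mem hi, Finset.sdiff_singleton_eq_erase]
          omega
      have hcancel (c : ℕ) (t : R)
          (ht : u i ^ c * t ∈ Ideal.span ((fun l => u l ^ d l) '' (T.erase i))) :
          t ∈ Ideal.span ((fun l => u l ^ d l) '' (T.erase i)) := by
        induction c with
        | zero => simpa using ht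
        | succ c ihc =>
          refine ihc (ih (T.erase i) d (fun l hl => hd l (Finset.mem_of_mem_erase hl)) (by omega) i
            (Finset.notMem_erase _ _) _ ?_)
          rwa [← mul_assoc, ← pow_succ']
      rw [mem_span_image_iff_of_mem hi] at hs ⊢
      obtain ⟨t, ht⟩ := hs
      rw [ha] at ht ⊢
      obtain ⟨s', hs'⟩ := hlower (a + 1) (by omega) le_rfl s ⟨u i * t, by convert ht using 1; ring⟩
      have h1 : u j * s' - u i * t ∈ Ideal.span ((fun l => u l ^ d l) '' (T.erase i)) := by
        apply hcancel (a + 1)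
        convert sub_mem ht (Ideal.mul_mem_left _ (u j) hs') using 1
        ring
      obtain ⟨s'', hs''⟩ := hlower 1 le_rfl (by omega) s' ⟨t, by simpa using h1⟩
      refine ⟨s'', ?_⟩
      convert add_mem hs' (Ideal.mul_mem_left _ (u i ^ (a + 1)) hs'') using 1
      ring

/-- A coefficient of the monomial `∏ u i ^ c i` which brings it into the ideal `(u i ^ (c i + 1))`
lies in the ideal generated by the family. -/
theorem mem_span_of_mul_prod_mem (hu : HasPrimeSubfamilies u) {T : Finset ι} (c : ι → ℕ) {r : R}
    (hr : r * ∏ i ∈ T, u i ^ c i ∈ Ideal.span ((fun i => u i ^ (c i + 1)) '' T)) :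
    r ∈ Ideal.span (u '' T) := by
  classical
  suffices ∀ S ⊆ T, r * ∏ i ∈ S, u i ^ c i ∈
      Ideal.span ((fun i => u i ^ (if i ∈ S then c i + 1 else 1)) '' T) →
      r ∈ Ideal.span (u '' T) by
    refine this T subset_rfl ?_
    convert hr using 2
    exact Set.image_congr fun i hi => by simp [Finset.mem_coe.1 hi]
  intro S
  induction S using Finset.induction_on with
  | empty => simp
  | insert a S ha ih =>
    intro hS hmem
    have haT : a ∈ T := hS (Finset.mem_insert_self _ _)
    refine ih ((Finset.subset_insert _ _).trans hS) ?_
    rw [mem_span_image_iff_of_mem haT] at hmem ⊢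
    have himage : (fun i => u i ^ (if i ∈ insert a S then c i + 1 else 1)) '' (T.erase a) =
        (fun i => u i ^ (if i ∈ S then c i + 1 else 1)) '' (T.erase a) :=
      Set.image_congr fun i hi => by
        have : i ≠ a := Finset.ne_of_mem_erase hi
        simp [this]
    rw [himage] at hmem
    obtain ⟨s, hs⟩ := hmem
    refine ⟨s, ?_⟩
    have hcancel (m : ℕ) (t : R) (ht : u a ^ m * t ∈
        Ideal.span ((fun i => u i ^ (if i ∈ S then c i + 1 else 1)) '' (T.erase a))) :
        t ∈ Ideal.span ((fun i => u i ^ (if i ∈ S then c i + 1 else 1)) '' (T.erase a)) := by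
      induction m with
      | zero => simpa using ht
      | succ m ihm =>
        refine ihm (hu.mem_span_pow_of_mul_mem _ (T.erase a) _ (fun l _ => ?_) le_rfl a
          (Finset.notMem_erase _ _) _ ?_)
        · split_ifs <;> omega
        · rwa [← mul_assoc, ← pow_succ']
    apply hcancel (c a)
    convert hs using 1
    simp only [Finset.prod_insert ha, Finset.mem_insert_self, if_true, ha, if_false]
    ring

end HasPrimeSubfamilies

section WeightIdeal

variable {R ι : Type*} [CommRing R] [Fintype ι]

/-- The ideal generated by the monomials in `u` of weight at least `p`, where `u i` has
weight `m i`. -/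
def weightIdeal (u : ι → R) (m : ι → ℕ) (p : ℕ) : Ideal R :=
  Ideal.span {x : R | ∃ c : ι → ℕ, p ≤ ∑ i, c i * m i ∧ x = ∏ i, u i ^ c i}

variable {u : ι → R} {m : ι → ℕ}

theorem prod_pow_mem_weightIdeal {p : ℕ} {c : ι → ℕ} (hc : p ≤ ∑ i, c i * m i) :
    ∏ i, u i ^ c i ∈ weightIdeal u m p :=
  Ideal.subset_span ⟨c, hc, rfl⟩

theorem weightIdeal_antitone : Antitone (weightIdeal u m) := fun _ _ h =>
  Ideal.span_mono fun _ ⟨c, hc, hx⟩ => ⟨c, h.trans hc, hx⟩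

theorem weightIdeal_zero : weightIdeal u m 0 = ⊤ := by
  rw [Ideal.eq_top_iff_one]
  simpa using prod_pow_mem_weightIdeal (u := u) (m := m) (c := 0) (Nat.zero_le _)

theorem weightIdeal_mul_le (p q : ℕ) :
    weightIdeal u m p * weightIdeal u m q ≤ weightIdeal u m (p + q) := by
  rw [weightIdeal, weightIdeal, Ideal.span_mul_span', Ideal.span_le]
  rintro _ ⟨_, ⟨c, hc, rfl⟩, _, ⟨d, hd, rfl⟩, rfl⟩
  simp only [← Finset.prod_mul_distrib, ← pow_add]
  apply prod_pow_mem_weightIdeal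
  simp only [add_mul, Finset.sum_add_distrib]
  omega

theorem mul_mem_weightIdeal {p q : ℕ} {x y : R} (hx : x ∈ weightIdeal u m p)
    (hy : y ∈ weightIdeal u m q) : x * y ∈ weightIdeal u m (p + q) :=
  weightIdeal_mul_le p q (Ideal.mul_mem_mul hx hy)

theorem weightIdeal_pow_le (p s : ℕ) : weightIdeal u m p ^ s ≤ weightIdeal u m (s * p) := by
  induction s with
  | zero => simp [weightIdeal_zero]
  | succ s ih =>
    rw [pow_succ, Nat.succ_mul]
    exact (Ideal.mul_mono_left ih).trans (weightIdeal_mul_le _ _)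

theorem pow_mem_weightIdeal {p : ℕ} {x : R} (hx : x ∈ weightIdeal u m p) (s : ℕ) :
    x ^ s ∈ weightIdeal u m (s * p) :=
  weightIdeal_pow_le p s (Ideal.pow_mem_pow hx s)

theorem weight_eq_sum (m : ι → ℕ) (c : ι →₀ ℕ) : Finsupp.weight m c = ∑ i, c i * m i := by
  simp [Finsupp.weight_apply, Finsupp.sum_fintype]

theorem eval_mem_weightIdeal {F : MvPolynomial ι R} {p : ℕ} (hF : F.IsWeightedHomogeneous m p) :
    MvPolynomial.eval u F ∈ weightIdeal u m p := by
  rw [MvPolynomial.eval_eq']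
  refine Ideal.sum_mem _ fun d hd => Ideal.mul_mem_left _ _ (prod_pow_mem_weightIdeal ?_)
  rw [← weight_eq_sum, hF (MvPolynomial.mem_support_iff.1 hd)]

theorem exists_isWeightedHomogeneous_of_mem_weightIdeal {p : ℕ} {f : R}
    (hf : f ∈ weightIdeal u m p) : ∃ F : MvPolynomial ι R, F.IsWeightedHomogeneous m p ∧
      f - MvPolynomial.eval u F ∈ weightIdeal u m (p + 1) := by
  refine Submodule.span_induction ?_ ?_ ?_ ?_ hf
  · rintro _ ⟨c, hc, rfl⟩
    rcases hc.eq_or_lt with h | h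
    · refine ⟨MvPolynomial.monomial (Finsupp.equivFunOnFinite.symm c) 1,
        MvPolynomial.isWeightedHomogeneous_monomial _ _ _ ?_, ?_⟩
      · rw [weight_eq_sum]; exact h.symm
      · simp [MvPolynomial.eval_monomial, Finsupp.prod_fintype]
    · exact ⟨0, MvPolynomial.isWeightedHomogeneous_zero _ _ _, by
        simpa using prod_pow_mem_weightIdeal h⟩
  · exact ⟨0, MvPolynomial.isWeightedHomogeneous_zero _ _ _, by simp⟩
  · rintro x y - - ⟨F, hF, hFx⟩ ⟨G, hG, hGy⟩
    refine ⟨F + G, hF.add hG, ?_⟩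
    convert add_mem hFx hGy using 1
    rw [map_add]; ring
  · rintro r x - ⟨F, hF, hFx⟩
    refine ⟨MvPolynomial.C r * F, ?_, ?_⟩
    · simpa using (MvPolynomial.isWeightedHomogeneous_C m r).mul hF
    · convert Ideal.mul_mem_left _ r hFx using 1
      simp; ring

namespace HasPrimeSubfamilies

/-- Weighted quasi-regularity. -/
theorem coeff_mem_of_eval_mem_weightIdeal (hu : HasPrimeSubfamilies u) (hm : ∀ i, 0 < m i)
    {F : MvPolynomial ι R} {p : ℕ} (hF : F.IsWeightedHomogeneous m p)
    (h : MvPolynomial.eval u F ∈ weightIdeal u m (p + 1)) (c : ι →₀ ℕ) :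
    F.coeff c ∈ Ideal.span (Set.range u) := by
  classical
  by_cases hc0 : F.coeff c = 0
  · rw [hc0]; exact zero_mem _
  have hcp : ∑ i, c i * m i = p := by rw [← weight_eq_sum]; exact hF hc0
  have hprod (d : ι → ℕ) (hd : p ≤ ∑ i, d i * m i) (hdc : d ≠ c) : ∏ i, u i ^ d i ∈
      Ideal.span ((fun i => u i ^ (c i + 1)) '' (Finset.univ : Finset ι)) := by
    obtain ⟨i, hi⟩ : ∃ i, c i < d i := by
      by_contra! hle
      obtain ⟨j, hj⟩ := Function.ne_iff.1 hdc
      have : ∑ i, d i * m i < ∑ i, c i * m i :=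
        Finset.sum_lt_sum (fun i _ => Nat.mul_le_mul_right _ (hle i))
          ⟨j, Finset.mem_univ _, Nat.mul_lt_mul_of_pos_right ((hle j).lt_of_ne hj) (hm j)⟩
      omega
    refine Ideal.mem_of_dvd _ ?_ (Ideal.subset_span ⟨i, by simp, rfl⟩)
    exact (pow_dvd_pow _ hi).trans (Finset.dvd_prod_of_mem (fun i => u i ^ d i) (Finset.mem_univ i))
  have hmem : MvPolynomial.eval u F ∈
      Ideal.span ((fun i => u i ^ (c i + 1)) '' (Finset.univ : Finset ι)) := by
    refine (Ideal.span_le.2 ?_) h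
    rintro _ ⟨d, hd, rfl⟩
    exact hprod d (by omega) (by rintro rfl; omega)
  rw [MvPolynomial.eval_eq', ← Finset.add_sum_erase _ _ (MvPolynomial.mem_support_iff.2 hc0)]
    at hmem
  have hrest : ∑ d ∈ F.support.erase c, F.coeff d * ∏ i, u i ^ d i ∈
      Ideal.span ((fun i => u i ^ (c i + 1)) '' (Finset.univ : Finset ι)) := by
    refine Ideal.sum_mem _ fun d hd => Ideal.mul_mem_left _ _ (hprod d ?_ ?_)
    · rw [← weight_eq_sum, hF (MvPolynomial.mem_support_iff.1 (Finset.mem_of_mem_erase hd))]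
    · exact fun h => Finset.ne_of_mem_erase hd (DFunLike.coe_injective h)
  simpa using hu.mem_span_of_mul_prod_mem (T := Finset.univ) c
    ((Ideal.add_mem_iff_left _ hrest).1 hmem)

/-- The graded ring of the filtration `weightIdeal u m` is reduced. -/
theorem mem_weightIdeal_succ_of_pow_mem (hu : HasPrimeSubfamilies u) (hm : ∀ i, 0 < m i)
    {p s : ℕ} {f : R} (hf : f ∈ weightIdeal u m p) (hs : f ^ s ∈ weightIdeal u m (s * p + 1)) :
    f ∈ weightIdeal u m (p + 1) := by
  obtain ⟨F, hF, hFf⟩ := exists_isWeightedHomogeneous_of_mem_weightIdeal hf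
  have hFp := eval_mem_weightIdeal (u := u) hF
  have hdiff : ∀ s : ℕ, f ^ s - MvPolynomial.eval u F ^ s ∈ weightIdeal u m (s * p + 1) := by
    intro s
    induction s with
    | zero => simp
    | succ s ih =>
      have h1 := mul_mem_weightIdeal (pow_mem_weightIdeal hf s) hFf
      have h2 := mul_mem_weightIdeal hFp ih
      rw [show s * p + (p + 1) = (s + 1) * p + 1 by ring] at h1
      rw [show p + (s * p + 1) = (s + 1) * p + 1 by ring] at h2
      convert add_mem h1 h2 using 1
      ring
  have hFs : MvPolynomial.eval u (F ^ s) ∈ weightIdeal u m (s * p + 1) := by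
    rw [map_pow]
    convert sub_mem hs (hdiff s) using 1
    ring
  have hFhom : (F ^ s).IsWeightedHomogeneous m (s * p) := by simpa using hF.pow s
  have hcoeff := hu.coeff_mem_of_eval_mem_weightIdeal hm hFhom hFs
  have hprime : (Ideal.span (Set.range u)).IsPrime := by simpa using hu.isPrime_span Finset.univ
  have hmap : MvPolynomial.map (Ideal.Quotient.mk (Ideal.span (Set.range u))) F = 0 := by
    have : MvPolynomial.map (Ideal.Quotient.mk (Ideal.span (Set.range u))) F ^ s = 0 := by
      ext c
      rw [← map_pow, MvPolynomial.coeff_map, MvPolynomial.coeff_zero]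
      exact Ideal.Quotient.eq_zero_iff_mem.2 (hcoeff c)
    exact eq_zero_of_pow_eq_zero this
  have hrange : Ideal.span (Set.range u) ≤ weightIdeal u m 1 := by
    classical
    rw [Ideal.span_le]
    rintro _ ⟨i, rfl⟩
    have h1 := prod_pow_mem_weightIdeal (u := u) (m := m) (p := 1) (c := Pi.single i 1)
      (by simpa [Pi.single_apply] using! hm i)
    simpa [Pi.single_apply, pow_ite] using! h1
  have heval : MvPolynomial.eval u F ∈ weightIdeal u m (p + 1) := by
    rw [MvPolynomial.eval_eq']
    refine Ideal.sum_mem _ fun d hd => ?_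
    rw [add_comm]
    refine mul_mem_weightIdeal (hrange ?_) (prod_pow_mem_weightIdeal ?_)
    · rw [← Ideal.Quotient.eq_zero_iff_mem, ← MvPolynomial.coeff_map, hmap,
        MvPolynomial.coeff_zero]
    · rw [← weight_eq_sum, hF (MvPolynomial.mem_support_iff.1 hd)]
  convert add_mem hFf heval using 1
  ring

/-- An element whose `N`-th power is integral over an ideal of elements of weight `≥ N ^ 2` has
weight `≥ N`. -/
theorem mem_weightIdeal_of_memIntegralClosureOfIdeal (hu : HasPrimeSubfamilies u)
    (hm : ∀ i, 0 < m i) {N : ℕ} {J : Ideal R} (hJ : J ≤ weightIdeal u m (N * N)) {f : R}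
    (hf : MemIntegralClosureOfIdeal J (f ^ N)) : f ∈ weightIdeal u m N := by
  obtain ⟨n, hn, c, hc, heq⟩ := hf
  suffices ∀ p ≤ N, f ∈ weightIdeal u m p from this N le_rfl
  intro p
  induction p with
  | zero => simp [weightIdeal_zero]
  | succ p ih =>
    intro hp
    have hfp := ih (by omega)
    refine hu.mem_weightIdeal_succ_of_pow_mem hm (s := N * n) hfp ?_
    rw [pow_mul, eq_neg_of_add_eq_zero_left heq]
    refine neg_mem (Ideal.sum_mem _ fun i _ => ?_)
    have h1 : c i ∈ weightIdeal u m ((i + 1) * (N * N)) :=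
      weightIdeal_pow_le _ _ (Ideal.pow_right_mono hJ _ (hc i))
    have h2 := pow_mem_weightIdeal (pow_mem_weightIdeal hfp N) (n - 1 - i)
    refine weightIdeal_antitone ?_ (mul_mem_weightIdeal h1 h2)
    obtain ⟨l, hl⟩ : ∃ l, n = l + (i + 1) := ⟨n - 1 - i, by omega⟩
    have hl' : n - 1 - (i : ℕ) = l := by omega
    rw [hl']
    have h3 : (i + 1) * (N * p) + 1 ≤ (i + 1) * (N * N) := by
      have : N * p < N * N := Nat.mul_lt_mul_of_pos_left hp (by omega)
      exact Nat.mul_lt_mul_of_pos_left this (by omega)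
    calc N * n * p + 1 = N * (l + (i + 1)) * p + 1 := by rw [← hl]
      _ = (i + 1) * (N * p) + 1 + l * (N * p) := by ring
      _ ≤ _ := by gcongr

end HasPrimeSubfamilies

/-- The determinant trick: `g` is integral over `J` if `g I ⊆ J I` for a nonzero finitely generated
ideal `I` of a domain. -/
theorem memIntegralClosureOfIdeal_of_mul_mem [IsDomain R] {I J : Ideal R} {g : R} (hI : I.FG)
    (hI0 : I ≠ ⊥) (h : ∀ x ∈ I, g * x ∈ J * I) : MemIntegralClosureOfIdeal J g := by
  have : Module.Finite R I := Module.Finite.iff_fg.2 hI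
  obtain ⟨P, hmonic, -, hcoeff, haeval⟩ :=
    LinearMap.exists_monic_and_natDegree_eq_and_coeff_mem_pow_and_aeval_eq_zero R
      (algebraMap R (Module.End R I) g) J (by
        rintro _ ⟨x, rfl⟩
        rw [Submodule.mem_smul_top_iff]
        exact h x x.2)
  obtain ⟨x, hx, hx0⟩ := Submodule.exists_mem_ne_zero_of_ne_bot hI0
  have hroot : P.eval g = 0 := by
    rw [Polynomial.aeval_algebraMap_apply] at haeval
    have := congrArg Subtype.val (LinearMap.congr_fun haeval ⟨x, hx⟩)
    simpa [hx0] using this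
  have hpos : 0 < P.natDegree := by
    rw [Nat.pos_iff_ne_zero]
    intro h0
    rw [hmonic.natDegree_eq_zero.1 h0] at hroot
    simp at hroot
  refine ⟨P.natDegree, hpos, fun i => P.coeff (P.natDegree - 1 - i), fun i => ?_, ?_⟩
  · have := hcoeff (P.natDegree - 1 - i)
    rwa [show P.natDegree - (P.natDegree - 1 - i) = i + 1 by omega] at this
  · rw [Polynomial.eval_eq_sum_range, Finset.sum_range_succ, hmonic.coeff_natDegree, one_mul,
      ← Finset.sum_range_reflect, add_comm] at hroot
    rw [← hroot, Finset.sum_range]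

theorem memIntegralClosureOfIdeal_of_mem_weightIdeal [IsNoetherianRing R] [IsDomain R]
    (hu : ∀ i, u i ≠ 0) {w : ℕ} (hw : 0 < w) {e : ι → ℕ}
    (he : ∀ i, e i * m i = w) {g : R} (hg : g ∈ weightIdeal u m w) :
    MemIntegralClosureOfIdeal (Ideal.span (Set.range fun i => u i ^ e i)) g := by
  classical
  set q := Fintype.card ι * w with hq
  refine memIntegralClosureOfIdeal_of_mul_mem (I := weightIdeal u m q)
    (IsNoetherian.noetherian _) ?_ fun x hx => ?_
  · refine ne_of_mem_of_not_mem' (a := ∏ i, u i ^ e i) (prod_pow_mem_weightIdeal ?_) ?_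
    · simp [he, hq]
    · simpa [Finset.prod_eq_zero_iff] using fun i h => absurd h (hu i)
  · have hle : weightIdeal u m (w + q) ≤
        Ideal.span (Set.range fun i => u i ^ e i) * weightIdeal u m q := by
      rw [weightIdeal, Ideal.span_le]
      rintro _ ⟨c, hc, rfl⟩
      obtain ⟨i, hi⟩ : ∃ i, w ≤ c i * m i := by
        by_contra! hlt
        have : ∑ i, c i * m i ≤ ∑ _i : ι, w := Finset.sum_le_sum fun i _ => (hlt i).le
        simp only [Finset.sum_const, Finset.card_univ, smul_eq_mul] at this
        omega
      have hmi : 0 < m i := Nat.pos_of_ne_zero fun h => by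
        have := he i
        rw [h] at this
        omega
      have hei : e i ≤ c i := by
        rw [← he i] at hi
        exact Nat.le_of_mul_le_mul_right hi hmi
      have hc' : c = Pi.single i (e i) + Function.update c i (c i - e i) := by
        ext j
        by_cases hj : j = i
        · subst hj; simp [hei]
        · simp [hj]
      have hsum : ∑ j, c j * m j = w + ∑ j, Function.update c i (c i - e i) j * m j := by
        conv_lhs => rw [hc']
        simp [add_mul, Finset.sum_add_distrib, Pi.single_apply, he]
      have hprod : ∏ j, u j ^ c j = u i ^ e i * ∏ j, u j ^ Function.update c i (c i - e i) j := by
        conv_lhs => rw [hc']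
        simp only [Pi.add_apply, pow_add, Finset.prod_mul_distrib]
        simp [Pi.single_apply, pow_ite]
      rw [hprod]
      exact Ideal.mul_mem_mul (Ideal.subset_span ⟨i, rfl⟩) (prod_pow_mem_weightIdeal (by omega))
    exact hle (mul_mem_weightIdeal hg hx)

end WeightIdeal

/-- Let `R` be a regular local ring, `u₁,…,u_k` part of a regular system of
parameters and `a₁,…,a_k` positive rationals.  Choose a sufficiently divisible `N > 0`, i.e.
such that all `N·a i` and `N/a i` are integers, and write `e i` for the natural number
`N * a i`.  Then the ideal of sections of the `Q`-ideal `(u₁^{a₁},…,u_k^{a_k})`, namely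
`{f : f^N` is integral over `(u₁^{e₁},…,u_k^{e_k})}`, is the ideal generated by the monomials
`u₁^{c₁}⋯u_k^{c_k}` with `c₁/a₁ + ⋯ + c_k/a_k ≥ 1`. -/
theorem sections_of_QIdeal_eq_monomial_ideal
    {R : Type*} [CommRing R] [IsLocalRing R] [IsNoetherianRing R] {k : ℕ}
    (u : Fin k → R) (hu : IsPartialRegSystemOfParams u)
    (a : Fin k → ℚ) (ha : ∀ i, 0 < a i)
    (N : ℕ) (hN : 0 < N)
    (hdiv : ∀ i, ∃ m : ℕ, (N : ℚ) / a i = m)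
    (e : Fin k → ℕ) (he : ∀ i, (e i : ℚ) = N * a i) :
    {f : R |
        MemIntegralClosureOfIdeal (Ideal.span (Set.range fun i => u i ^ e i)) (f ^ N)} =
      ↑(Ideal.span {x : R | ∃ c : Fin k → ℕ,
          (1 : ℚ) ≤ ∑ i, (c i : ℚ) / a i ∧ x = ∏ i, u i ^ c i}) := by
  choose m hm using hdiv
  have hN' : (0 : ℚ) < N := by exact_mod_cast hN
  have hmpos (i : Fin k) : 0 < m i := by
    have : (0 : ℚ) < m i := hm i ▸ div_pos hN' (ha i)
    exact_mod_cast this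
  have hem (i : Fin k) : e i * m i = N * N := by
    have : (e i : ℚ) * m i = N * N := by
      rw [he, ← hm]
      field_simp [(ha i).ne']
    exact_mod_cast this
  have hweight : Ideal.span {x : R | ∃ c : Fin k → ℕ,
      (1 : ℚ) ≤ ∑ i, (c i : ℚ) / a i ∧ x = ∏ i, u i ^ c i} = weightIdeal u m N := by
    have hiff (c : Fin k → ℕ) : (1 : ℚ) ≤ ∑ i, (c i : ℚ) / a i ↔ N ≤ ∑ i, c i * m i := by
      rw [← Nat.cast_le (α := ℚ), ← mul_le_mul_iff_right₀ hN', mul_one, Finset.mul_sum]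
      push_cast
      simp only [← hm]
      rw [Finset.sum_congr rfl fun i _ => mul_div_left_comm (N : ℚ) (c i) (a i)]
    simp only [hiff, weightIdeal]
  have hP := hu.hasPrimeSubfamilies
  have := hP.isDomain
  ext f
  rw [hweight]
  constructor
  · refine hP.mem_weightIdeal_of_memIntegralClosureOfIdeal hmpos (Ideal.span_le.2 ?_)
    rintro _ ⟨i, rfl⟩
    have h1 := prod_pow_mem_weightIdeal (u := u) (m := m) (p := N * N) (c := Pi.single i (e i))
      (by simp [Pi.single_apply, hem])
    simpa [Pi.single_apply, pow_ite] using h1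
  · intro hf
    exact memIntegralClosureOfIdeal_of_mem_weightIdeal hP.ne_zero (Nat.mul_pos hN hN) hem
      (pow_mem_weightIdeal hf N)
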